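/- Let (Ω,F,P,θ) be a measure-preserving dynamical system with θ ergodic, and let C:Ω→ℝ be measurable. If the function C∘θ−C has a P-integrable minorant, then C is adjusted to θ, i.e. lim_{|n|→∞}(1/|n|)C(θ^n ω)=0 for P-a.e. ω∈Ω. -/

import Mathlib

open MeasureTheory Metric Filter

/-- Running maxima of the Birkhoff sums of `g`. -/
noncomputable def runMax {Ω : Type*} (T : Ω → Ω) (g : Ω → ℝ) : ℕ → Ω → ℝ
  | 0 => fun _ => 0
  | n + 1 => fun x => max 0 (g x + runMax T g n (T x))

lemma runMax_nonneg {Ω : Type*} (T : Ω → Ω) (g : Ω → ℝ) (n : ℕ) (x : Ω) :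
    0 ≤ runMax T g n x := by
  cases n with
  | zero => simp [runMax]
  | succ n => exact le_max_left _ _

lemma runMax_mono {Ω : Type*} (T : Ω → Ω) (g : Ω → ℝ) (n : ℕ) :
    ∀ x, runMax T g n x ≤ runMax T g (n + 1) x := by
  induction n with
  | zero => intro x; exact runMax_nonneg T g 1 x
  | succ n ih =>
    intro x
    exact max_le_max le_rfl (add_le_add le_rfl (ih (T x)))

lemma birkhoffSum_le_runMax {Ω : Type*} (T : Ω → Ω) (g : Ω → ℝ) (n : ℕ) :
    ∀ x, birkhoffSum T g n x ≤ runMax T g n x := by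
  induction n with
  | zero => intro x; simp [runMax]
  | succ n ih =>
    intro x
    rw [birkhoffSum_succ']
    exact (add_le_add le_rfl (ih (T x))).trans (le_max_right _ _)

lemma runMax_measurable {Ω : Type*} [MeasurableSpace Ω] {T : Ω → Ω} {g : Ω → ℝ}
    (hT : Measurable T) (hg : Measurable g) (n : ℕ) : Measurable (runMax T g n) := by
  induction n with
  | zero => exact measurable_const
  | succ n ih => exact measurable_const.max (hg.add (ih.comp hT))

lemma runMax_integrable {Ω : Type*} [MeasurableSpace Ω] {P : Measure Ω} [IsProbabilityMeasure P]
    {T : Ω → Ω} {g : Ω → ℝ}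
    (hT : MeasurePreserving T P P) (hg : Integrable g P) (n : ℕ) :
    Integrable (runMax T g n) P := by
  induction n with
  | zero => exact integrable_const _
  | succ n ih => exact (integrable_const (0 : ℝ)).sup (hg.add (hT.integrable_comp_of_integrable ih))

lemma birkhoff_bdd {Ω : Type*} [MeasurableSpace Ω] {P : Measure Ω} [IsProbabilityMeasure P]
    {T : Ω → Ω} {g : Ω → ℝ} (hT : Ergodic T P) (hgm : Measurable g) (hg : Integrable g P)
    (hneg : ∫ x, g x ∂P < 0) :
    ∀ᵐ x ∂P, ∃ B : ℝ, ∀ n, birkhoffSum T g n x ≤ B := by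
  have hMP := hT.toMeasurePreserving
  have hTm := hMP.measurable
  set A : Set Ω := {x | ∀ B : ℕ, ∃ n, (B : ℝ) < runMax T g n x} with hA
  have hAm : MeasurableSet A := by
    have : A = ⋂ B : ℕ, ⋃ n, {x | (B : ℝ) < runMax T g n x} := by
      ext x; simp [hA]
    rw [this]
    exact MeasurableSet.iInter fun B => MeasurableSet.iUnion fun n =>
      measurableSet_lt measurable_const (runMax_measurable hTm hgm n)
  have hinv : T ⁻¹' A = A := by
    ext x
    simp only [hA, Set.mem_preimage, Set.mem_ofPred_eq]
    constructor
    · intro h B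
      obtain ⟨k, hk⟩ := exists_nat_gt ((B : ℝ) - g x)
      obtain ⟨n, hn⟩ := h k
      refine ⟨n + 1, lt_of_lt_of_le ?_ (le_max_right _ _)⟩
      linarith
    · intro h B
      obtain ⟨k, hk⟩ := exists_nat_gt (g x + B)
      obtain ⟨n, hn⟩ := h k
      cases n with
      | zero =>
        exact absurd hn (not_lt.2 (by simp [runMax]))
      | succ n =>
        refine ⟨n, ?_⟩
        have hk0 : (0 : ℝ) ≤ k := Nat.cast_nonneg k
        rcases lt_max_iff.1 hn with h1 | h1
        · linarith
        · linarith
  have hmono : ∀ x, Monotone fun n => runMax T g n x := fun x =>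
    monotone_nat_of_le_succ fun n => runMax_mono T g n x
  rcases hT.toPreErgodic.ae_empty_or_univ hAm hinv with h | h
  · have h0 : ∀ᵐ x ∂P, x ∉ A := by
      filter_upwards [h] with x hx hxA
      have : (x ∈ A) = (x ∈ (∅ : Set Ω)) := hx
      rw [this] at hxA
      exact hxA
    filter_upwards [h0] with x hx
    simp only [hA, Set.mem_ofPred_eq, not_forall, not_exists, not_lt] at hx
    obtain ⟨B, hB⟩ := hx
    exact ⟨B, fun n => (birkhoffSum_le_runMax T g n x).trans (hB n)⟩
  · exfalso
    have h1 : ∀ᵐ x ∂P, x ∈ A := by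
      filter_upwards [h] with x hx
      have : (x ∈ A) = (x ∈ (Set.univ : Set Ω)) := hx
      rw [this]; trivial
    have h2 : ∀ᵐ x ∂P, T x ∈ A := by
      filter_upwards [h1] with x hx
      have : x ∈ T ⁻¹' A := by rw [hinv]; exact hx
      exact this
    have hform : ∀ n x, runMax T g (n + 1) x - runMax T g n (T x)
        = max (- runMax T g n (T x)) (g x) := by
      intro n x
      simp only [runMax]
      rw [← max_sub_sub_right]
      congr 1 <;> ring
    have hlim : Tendsto (fun n => ∫ x, (runMax T g (n + 1) x - runMax T g n (T x)) ∂P) atTop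
        (nhds (∫ x, g x ∂P)) := by
      refine tendsto_integral_of_dominated_convergence (fun x => |g x|) ?_ hg.abs ?_ ?_
      · intro n
        exact ((runMax_measurable hTm hgm (n+1)).sub
          ((runMax_measurable hTm hgm n).comp hTm)).aestronglyMeasurable
      · intro n
        refine Eventually.of_forall fun x => ?_
        rw [hform, Real.norm_eq_abs]
        have := runMax_nonneg T g n (T x)
        rcases max_cases (- runMax T g n (T x)) (g x) with ⟨h, h'⟩ | ⟨h, h'⟩ <;> rw [h]
        rw [abs_neg, abs_of_nonneg this]
        have := neg_abs_le (g x)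
        linarith
      · filter_upwards [h2] with x hx
        refine tendsto_const_nhds.congr' ?_
        obtain ⟨k, hk⟩ := exists_nat_gt (- g x)
        obtain ⟨m, hm⟩ := hx k
        filter_upwards [eventually_ge_atTop m] with n hn
        rw [hform, max_eq_right]
        have := hmono (T x) hn
        simp only at this
        linarith
    have hge : 0 ≤ ∫ x, g x ∂P := by
      refine ge_of_tendsto' hlim fun n => ?_
      have hi := runMax_integrable hMP hg
      have hiT : Integrable (fun x => runMax T g n (T x)) P :=
        hMP.integrable_comp_of_integrable (hi n)
      rw [integral_sub (hi (n+1)) hiT]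
      have : ∫ x, runMax T g n (T x) ∂P = ∫ x, runMax T g n x ∂P := by
        conv_rhs => rw [← hMP.map_eq]
        rw [integral_map hTm.aemeasurable (runMax_measurable hTm hgm n).aestronglyMeasurable]
      rw [this, sub_nonneg]
      exact integral_mono (hi n) (hi (n+1)) (runMax_mono T g n)
    linarith

lemma cob_upper {Ω : Type*} [MeasurableSpace Ω] {P : Measure Ω} [IsProbabilityMeasure P]
    {T : Ω → Ω} {D : Ω → ℝ} (hT : Ergodic T P) (hD : Measurable D)
    (hi : Integrable (fun x => D (T x) - D x) P) (h0 : ∫ x, (D (T x) - D x) ∂P = 0) :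
    ∀ᵐ x ∂P, ∀ k : ℕ, ∃ B : ℝ, ∀ n : ℕ, D (T^[n] x) ≤ B + n * (1 / ((k : ℝ) + 1)) := by
  rw [ae_all_iff]
  intro k
  have hk : 0 < 1 / ((k : ℝ) + 1) := by positivity
  have := birkhoff_bdd (g := fun x => D (T x) - D x - 1 / ((k : ℝ) + 1)) hT
    (((hD.comp hT.measurable).sub hD).sub measurable_const) (hi.sub (integrable_const _)) (by
      rw [integral_sub hi (integrable_const _), h0]
      simp only [integral_const, probReal_univ, smul_eq_mul]
      linarith)
  filter_upwards [this] with x hx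
  obtain ⟨B, hB⟩ := hx
  refine ⟨B + D x, fun n => ?_⟩
  have hS : birkhoffSum T (fun x => D (T x) - D x - 1 / ((k : ℝ) + 1)) n x
      = D (T^[n] x) - D x - n * (1 / ((k : ℝ) + 1)) := by
    induction n with
    | zero => simp
    | succ n ih =>
      rw [birkhoffSum_succ, ih, Function.iterate_succ_apply']
      push_cast; ring
  have := hB n
  rw [hS] at this
  linarith

lemma cob_tendsto {Ω : Type*} [MeasurableSpace Ω] {P : Measure Ω} [IsProbabilityMeasure P]
    {T : Ω → Ω} {D : Ω → ℝ} (hT : Ergodic T P) (hD : Measurable D)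
    (hi : Integrable (fun x => D (T x) - D x) P) (h0 : ∫ x, (D (T x) - D x) ∂P = 0) :
    ∀ᵐ x ∂P, Tendsto (fun n : ℕ => D (T^[n] x) / n) atTop (nhds 0) := by
  have e : (fun x => (-D (T x)) - (-D x)) = fun x => -(D (T x) - D x) := by
    ext x; ring
  filter_upwards [cob_upper hT hD hi h0, cob_upper (D := fun x => -D x) hT hD.neg
    (by rw [e]; exact hi.neg) (by rw [e, integral_neg, h0, neg_zero])] with x h1 h2
  rw [Metric.tendsto_atTop]
  intro ε hε
  obtain ⟨k, hk⟩ := exists_nat_one_div_lt (half_pos hε)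
  obtain ⟨B1, hB1⟩ := h1 k
  obtain ⟨B2, hB2⟩ := h2 k
  obtain ⟨N, hN⟩ := exists_nat_gt (max B1 B2 / (ε / 2))
  refine ⟨N + 1, fun n hn => ?_⟩
  have hn' : (N : ℝ) + 1 ≤ n := by exact_mod_cast hn
  have hN0 : (0 : ℝ) ≤ N := Nat.cast_nonneg N
  have hnpos : (0 : ℝ) < n := by linarith
  rw [div_lt_iff₀ (half_pos hε)] at hN
  have hb : max B1 B2 < n * (ε / 2) := hN.trans_le (by gcongr; linarith)
  have hk' : n * (1 / ((k : ℝ) + 1)) < n * (ε / 2) := by gcongr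
  have a1 := hB1 n
  have a2 := hB2 n
  have b1 := le_max_left B1 B2
  have b2 := le_max_right B1 B2
  rw [Real.dist_eq, sub_zero, abs_div, abs_of_pos hnpos, div_lt_iff₀ hnpos, abs_lt]
  constructor <;> linarith

/-- Truncation at level `k`. -/
noncomputable def trunc (k : ℕ) (t : ℝ) : ℝ := max (-(k : ℝ)) (min t k)

lemma trunc_diff (k : ℕ) (a b : ℝ) :
    min (a - b) 0 ≤ trunc k a - trunc k b ∧ |trunc k a - trunc k b| ≤ |a - b| := by
  have hk : (0 : ℝ) ≤ k := Nat.cast_nonneg k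
  unfold trunc
  have h2 : |max (-(k : ℝ)) (min a k) - max (-(k : ℝ)) (min b k)| ≤ |a - b| := by
    refine (abs_max_sub_max_le_max _ _ _ _).trans ?_
    rw [sub_self, abs_zero, max_eq_right (abs_nonneg _)]
    refine (abs_min_sub_min_le_max _ _ _ _).trans ?_
    simp
  refine ⟨?_, h2⟩
  rcases le_total a b with h | h
  · rw [min_eq_left (by linarith)]
    rw [abs_of_nonpos (by linarith : a - b ≤ 0)] at h2
    have := (abs_le.1 h2).1
    linarith
  · rw [min_eq_right (by linarith), sub_nonneg]
    exact max_le_max le_rfl (min_le_min h le_rfl)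

lemma trunc_tendsto (t : ℝ) : Tendsto (fun k : ℕ => trunc k t) atTop (nhds t) := by
  refine tendsto_const_nhds.congr' ?_
  obtain ⟨K, hK⟩ := exists_nat_gt |t|
  filter_upwards [eventually_ge_atTop K] with k hk
  have hk' : (K : ℝ) ≤ k := by exact_mod_cast hk
  have := abs_lt.1 hK
  unfold trunc
  rw [min_eq_left (by linarith), max_eq_right (by linarith)]

lemma trunc_measurable (k : ℕ) : Measurable (trunc k) :=
  measurable_const.max (measurable_id.min measurable_const)

lemma trunc_bdd (k : ℕ) (t : ℝ) : |trunc k t| ≤ k := by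
  have hk : (0 : ℝ) ≤ k := Nat.cast_nonneg k
  unfold trunc
  rw [abs_le]
  exact ⟨le_max_left _ _, max_le (by linarith) (min_le_right _ _)⟩

lemma cob_integrable {Ω : Type*} [MeasurableSpace Ω] {P : Measure Ω} [IsProbabilityMeasure P]
    {T : Ω → Ω} {C G : Ω → ℝ} (hT : MeasurePreserving T P P) (hC : Measurable C)
    (hG : Integrable G P) (hmin : ∀ ω, G ω ≤ C (T ω) - C ω) :
    Integrable (fun x => C (T x) - C x) P ∧ ∫ x, (C (T x) - C x) ∂P = 0 := by
  have hTm := hT.measurable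
  set F : ℕ → Ω → ℝ := fun k x => trunc k (C (T x)) - trunc k (C x) with hF
  have hFm : ∀ k, Measurable (F k) := fun k =>
    ((trunc_measurable k).comp (hC.comp hTm)).sub ((trunc_measurable k).comp hC)
  have hci : ∀ k : ℕ, Integrable (fun x => trunc k (C x)) P := fun k =>
    Integrable.of_bound ((trunc_measurable k).comp hC).aestronglyMeasurable (k : ℝ)
      (Eventually.of_forall fun x => trunc_bdd k (C x))
  have hciT : ∀ k : ℕ, Integrable (fun x => trunc k (C (T x))) P := fun k =>
    hT.integrable_comp_of_integrable (hci k)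
  have hFi : ∀ k, Integrable (F k) P := fun k => (hciT k).sub (hci k)
  have hF0 : ∀ k, ∫ x, F k x ∂P = 0 := by
    intro k
    rw [hF]
    simp only
    rw [integral_sub (hciT k) (hci k), sub_eq_zero]
    conv_rhs => rw [← hT.map_eq]
    exact (integral_map hTm.aemeasurable
      ((trunc_measurable k).comp hC).aestronglyMeasurable).symm
  have hlim : ∀ x, Tendsto (fun k => F k x) atTop (nhds (C (T x) - C x)) := fun x =>
    (trunc_tendsto _).sub (trunc_tendsto _)
  have hFlow : ∀ k x, -|G x| ≤ F k x := by
    intro k x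
    refine le_trans ?_ (trunc_diff k (C (T x)) (C x)).1
    refine le_min ((neg_abs_le _).trans (hmin x)) (by simp)
  have hInt : Integrable (fun x => C (T x) - C x) P := by
    refine ⟨((hC.comp hTm).sub hC).aestronglyMeasurable, ?_⟩
    have hae : ∀ x, Tendsto (fun k => ‖F k x‖ₑ) atTop (nhds ‖C (T x) - C x‖ₑ) :=
      fun x => (hlim x).enorm
    have hbd : ∀ k, ∫⁻ x, ‖F k x‖ₑ ∂P ≤ ENNReal.ofReal (2 * ∫ x, |G x| ∂P) := by
      intro k
      rw [← ofReal_integral_norm_eq_lintegral_enorm (hFi k)]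
      refine ENNReal.ofReal_le_ofReal ?_
      have : ∫ x, ‖F k x‖ ∂P ≤ ∫ x, (F k x + 2 * |G x|) ∂P := by
        refine integral_mono (hFi k).norm ((hFi k).add (hG.abs.const_mul 2)) fun x => ?_
        have := hFlow k x
        have h0 := abs_nonneg (G x)
        simp only [Real.norm_eq_abs]
        rw [abs_le]
        constructor <;> linarith
      refine this.trans ?_
      rw [integral_add (hFi k) (hG.abs.const_mul 2), hF0, zero_add, integral_const_mul]
    have hfat : ∫⁻ x, ‖C (T x) - C x‖ₑ ∂P ≤ ENNReal.ofReal (2 * ∫ x, |G x| ∂P) := by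
      calc ∫⁻ x, ‖C (T x) - C x‖ₑ ∂P = ∫⁻ x, liminf (fun k => ‖F k x‖ₑ) atTop ∂P := by
            refine lintegral_congr fun x => ((hae x).liminf_eq).symm
        _ ≤ liminf (fun k => ∫⁻ x, ‖F k x‖ₑ ∂P) atTop :=
            lintegral_liminf_le fun k => (hFm k).enorm
        _ ≤ liminf (fun _ : ℕ => ENNReal.ofReal (2 * ∫ x, |G x| ∂P)) atTop :=
            liminf_le_liminf (Eventually.of_forall hbd)
        _ = _ := by simp
    exact hfat.trans_lt ENNReal.ofReal_lt_top
  refine ⟨hInt, ?_⟩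
  have := tendsto_integral_of_dominated_convergence (μ := P) (F := F)
    (fun x => |C (T x) - C x|) (fun k => (hFm k).aestronglyMeasurable) hInt.abs
    (fun k => Eventually.of_forall fun x => (trunc_diff k (C (T x)) (C x)).2)
    (Eventually.of_forall hlim)
  simp only [hF0] at this
  exact tendsto_nhds_unique this tendsto_const_nhds |>.trans rfl

/-- Let `(Ω,F,P,θ)` be a measure-preserving dynamical system with `θ`
an ergodic, bi-measurable, measure-preserving bijection, and `C : Ω → ℝ` measurable.
If `C ∘ θ − C` has a `P`-integrable minorant, then `C` is adjusted to `θ`, i.e.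
`lim_{|n|→∞} (1/|n|) C(θ^n ω) = 0` for `P`-a.e. `ω`. -/
theorem stmt6 {Ω : Type*} [MeasurableSpace Ω]
    (P : Measure Ω) [IsProbabilityMeasure P]
    (θ θinv : Ω → Ω) (hθm : Measurable θ) (hθim : Measurable θinv)
    (hli : Function.LeftInverse θinv θ) (hri : Function.RightInverse θinv θ)
    (herg : Ergodic θ P)
    (C : Ω → ℝ) (hC : Measurable C)
    (G : Ω → ℝ) (hG : Integrable G P)
    (hmin : ∀ ω, G ω ≤ C (θ ω) - C ω) :
    ∀ᵐ ω ∂P, Tendsto (fun n : ℕ => C (θ^[n] ω) / n) atTop (nhds 0) ∧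
      Tendsto (fun n : ℕ => C (θinv^[n] ω) / n) atTop (nhds 0) := by
  have hMP := herg.toMeasurePreserving
  obtain ⟨hi, h0⟩ := cob_integrable hMP hC hG hmin
  let e : Ω ≃ᵐ Ω :=
    { toFun := θ, invFun := θinv, left_inv := hli, right_inv := hri
      measurable_toFun := hθm, measurable_invFun := hθim }
  have hMPi : MeasurePreserving θinv P P := MeasurePreserving.symm e hMP
  have hergi : Ergodic θinv P := by
    refine ⟨hMPi, ⟨fun s hs hinv => ?_⟩⟩
    refine herg.toPreErgodic.aeconst_set hs ?_
    conv_lhs => rw [← hinv]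
    rw [← Set.preimage_comp, hli.comp_eq_id, Set.preimage_id]
  have hFi := hMPi.integrable_comp_of_integrable hi
  have eq : (fun x => C (θinv x) - C x) = fun x => -((fun x => C (θ x) - C x) ∘ θinv) x := by
    ext x
    simp only [Function.comp_apply, hri x]
    ring
  have hFm : Measurable (fun x => C (θ x) - C x) := (hC.comp hθm).sub hC
  have h0i : ∫ x, (C (θinv x) - C x) ∂P = 0 := by
    rw [eq, integral_neg, neg_eq_zero, ← h0]
    conv_rhs => rw [← hMPi.map_eq]
    rw [integral_map hθim.aemeasurable hFm.aestronglyMeasurable]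
    rfl
  filter_upwards [cob_tendsto herg hC hi h0,
    cob_tendsto hergi hC (by rw [eq]; exact hFi.neg) h0i] with x h1 h2
  exact ⟨h1, h2⟩
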